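/- If X is a log-concave integer-valued random variable with Var(X) ≤ 1, then for all real β ≥ 1, E[|X − E[X]|^β]^{1/β} ≤ 3·Γ(β+1)^{1/β}, where Γ denotes the Gamma function. -/

import Mathlib

open MeasureTheory ProbabilityTheory
open scoped ProbabilityTheory

/-- A function `p : ℤ → ℝ` is a log-concave probability mass function if
`p(k)² ≥ p(k-1)·p(k+1)` for all `k ∈ ℤ` and its support is an integer interval. -/
def IsLogConcavePMF (p : ℤ → ℝ) : Prop :=
  (∀ k : ℤ, p (k - 1) * p (k + 1) ≤ p k ^ 2) ∧
  (∀ a b c : ℤ, a ≤ b → b ≤ c → 0 < p a → 0 < p c → 0 < p b)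


lemma lc_gen (p : ℤ → ℝ) (h0 : ∀ k, 0 ≤ p k) (h1 : ∀ k : ℤ, p (k - 1) * p (k + 1) ≤ p k ^ 2)
    (h2 : ∀ a b c : ℤ, a ≤ b → b ≤ c → 0 < p a → 0 < p c → 0 < p b) (k : ℤ) (i : ℕ) :
    p (k - 1) * p (k + 1 + i) ≤ p k * p (k + i) := by
  induction i with
  | zero => have := h1 k; simp; nlinarith
  | succ i ih =>
    have hL := h1 (k + 1 + i)
    rw [show k + 1 + (i:ℤ) - 1 = k + i by ring] at hL
    push_cast
    rw [show k + 1 + ((i:ℤ) + 1) = k + 1 + i + 1 by ring, show k + ((i:ℤ) + 1) = k + 1 + i by ring]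
    rcases (h0 (k-1)).eq_or_lt with ha | ha
    · rw [← ha, zero_mul]; exact mul_nonneg (h0 _) (h0 _)
    rcases (h0 (k + 1 + i + 1)).eq_or_lt with he | he
    · rw [← he, mul_zero]; exact mul_nonneg (h0 _) (h0 _)
    have hc := h2 (k-1) (k+i) (k+1+i+1) (by omega) (by omega) ha he
    have hd := h2 (k-1) (k+1+i) (k+1+i+1) (by omega) (by omega) ha he
    have := mul_le_mul ih hL (mul_nonneg hc.le he.le) (mul_nonneg (h0 k) hc.le)
    refine le_of_mul_le_mul_right ?_ (mul_pos hc hd)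
    nlinarith

/-- survival function is log-concave -/
lemma surv_lc (p G : ℤ → ℝ) (h0 : ∀ k, 0 ≤ p k) (h1 : ∀ k : ℤ, p (k - 1) * p (k + 1) ≤ p k ^ 2)
    (h2 : ∀ a b c : ℤ, a ≤ b → b ≤ c → 0 < p a → 0 < p c → 0 < p b)
    (hG : ∀ k, HasSum (fun i : ℕ => p (k + i)) (G k)) (hs : ∀ k, G k = p k + G (k+1)) (k : ℤ) :
    G (k - 1) * G (k + 1) ≤ G k ^ 2 := by
  have h := hasSum_le (fun i => lc_gen p h0 h1 h2 k i) ((hG (k+1)).mul_left (p (k-1))) ((hG k).mul_left (p k))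
  have a := hs k
  have b := hs (k-1)
  rw [sub_add_cancel] at b
  rw [b]; rw [show p k = G k - G (k+1) by linarith] at h; nlinarith

lemma surv_step (G : ℤ → ℝ) (h0 : ∀ k, 0 ≤ G k) (hlc : ∀ k, G (k - 1) * G (k + 1) ≤ G k ^ 2)
    (hmono : ∀ k, G (k+1) ≤ G k)
    (ρ : ℝ) (hρ : 0 ≤ ρ) (k : ℤ) (h : G (k+1) ≤ ρ * G k) : G (k + 2) ≤ ρ * G (k+1) := by
  have h3 := hlc (k+1)
  rw [add_sub_cancel_right, add_assoc, one_add_one_eq_two] at h3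
  rcases (h0 k).eq_or_lt with ha | ha
  · have := hmono k; have := hmono (k+1); rw [add_assoc, one_add_one_eq_two] at this
    have := h0 (k+1); have : G (k+1) = 0 := by linarith
    rw [this]; linarith
  · refine le_of_mul_le_mul_left ?_ ha
    nlinarith [h0 (k+1)]

lemma surv_geo (G : ℤ → ℝ) (h0 : ∀ k, 0 ≤ G k) (hlc : ∀ k, G (k - 1) * G (k + 1) ≤ G k ^ 2)
    (hmono : ∀ k, G (k+1) ≤ G k)
    (ρ : ℝ) (hρ : 0 ≤ ρ) (k : ℤ) (h : G (k+1) ≤ ρ * G k) (i : ℕ) :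
    G (k + 1 + i) ≤ ρ ^ i * G (k+1) ∧ G (k + 1 + i) ≤ ρ * G (k + i) := by
  induction i with
  | zero => simpa using h
  | succ i ih =>
    have h3 := surv_step G h0 hlc hmono ρ hρ (k+i) (by convert ih.2 using 2; ring)
    rw [show k + (i:ℤ) + 2 = k + 1 + (i+1:ℕ) by push_cast; ring] at h3
    refine ⟨?_, by convert h3 using 3; push_cast; ring⟩
    rw [show k + (i:ℤ) + 1 = k + 1 + i by ring] at h3
    calc _ ≤ _ := h3
      _ ≤ ρ * (ρ ^ i * G (k+1)) := by gcongr; exact ih.1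
      _ = _ := by ring

lemma surv_geo_n (G : ℤ → ℝ) (h0 : ∀ k, 0 ≤ G k) (hlc : ∀ k, G (k - 1) * G (k + 1) ≤ G k ^ 2)
    (hmono : ∀ k, G (k+1) ≤ G k)
    (ρ : ℝ) (hρ : 0 ≤ ρ) (k : ℤ) (n : ℕ) (h : G (k+n+1) ≤ ρ ^ (n+1) * G k) (i : ℕ) :
    G (k + n + 1 + i) ≤ ρ ^ i * G (k+n+1) := by
  refine (surv_geo G h0 hlc hmono ρ hρ (k+n) ?_ i).1
  by_contra hc
  push Not at hc
  have key : ∀ j : ℕ, j ≤ n → ρ * G (k + j) < G (k + j + 1) := by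
    intro j hj
    by_contra hc2
    push Not at hc2
    have := (surv_geo G h0 hlc hmono ρ hρ (k+j) hc2 (n-j)).2
    rw [Nat.cast_sub hj, show k + (j:ℤ) + 1 + (n - j) = k + n + 1 by ring, show k + (j:ℤ) + (n - j) = k + n by ring] at this
    linarith
  have key2 : ∀ j : ℕ, j ≤ n → ρ ^ (j+1) * G k < G (k + j + 1) := by
    intro j
    induction j with
    | zero => intro hj; simpa using key 0 hj
    | succ j ih =>
      intro hj
      have a := ih (by omega)
      have b := key (j+1) hj
      push_cast at b ⊢
      rw [← add_assoc] at b ⊢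
      calc _ = ρ * (ρ^(j+1) * G k) := by ring
        _ ≤ ρ * G (k+j+1) := by gcongr
        _ < _ := b
  have := key2 n le_rfl
  linarith

/-- combined one-sided facts -/
lemma surv_props {Ω : Type*} [MeasurableSpace Ω] (μ : Measure Ω) [IsProbabilityMeasure μ]
    (X : Ω → ℤ) (hX : Measurable X)
    (h1 : ∀ k : ℤ, μ.real (X ⁻¹' {k - 1}) * μ.real (X ⁻¹' {k + 1}) ≤ μ.real (X ⁻¹' {k}) ^ 2)
    (h2 : ∀ a b c : ℤ, a ≤ b → b ≤ c → 0 < μ.real (X ⁻¹' {a}) → 0 < μ.real (X ⁻¹' {c}) →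
      0 < μ.real (X ⁻¹' {b})) :
    (∀ k, μ.real {ω | k - 1 ≤ X ω} * μ.real {ω | k + 1 ≤ X ω} ≤ μ.real {ω | k ≤ X ω} ^ 2) ∧
    (∀ k, μ.real {ω | k + 1 ≤ X ω} ≤ μ.real {ω | k ≤ X ω}) := by
  have hm : ∀ k : ℤ, MeasurableSet {ω | k ≤ X ω} := fun k => measurableSet_le measurable_const hX
  refine ⟨?_, fun k => measureReal_mono (fun ω (h : k + 1 ≤ X ω) => by show k ≤ X ω; omega)⟩
  refine surv_lc (fun k => μ.real (X ⁻¹' {k})) (fun k => μ.real {ω | k ≤ X ω}) (fun _ => measureReal_nonneg) h1 h2 ?_ ?_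
  · intro k
    have hu : {ω | k ≤ X ω} = ⋃ i : ℕ, X ⁻¹' {k + (i:ℤ)} := by
      ext ω
      simp only [Set.mem_ofPred_eq, Set.mem_iUnion, Set.mem_preimage, Set.mem_singleton_iff]
      constructor
      · intro h; exact ⟨(X ω - k).toNat, by omega⟩
      · rintro ⟨i, hi⟩; omega
    have hd : Pairwise (Function.onFun Disjoint fun i : ℕ => X ⁻¹' {k + (i:ℤ)}) := by
      intro i j hij
      refine Disjoint.preimage _ ?_
      simp only [Set.disjoint_singleton]
      omega
    have := (measure_iUnion (μ := μ) hd (fun i => hX (measurableSet_singleton _)))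
    have hne : ∑' i : ℕ, μ (X ⁻¹' {k + (i:ℤ)}) ≠ ⊤ := by rw [← this]; exact measure_ne_top _ _
    simp only [hu, measureReal_def, this]
    rw [ENNReal.tsum_toReal_eq (fun i => measure_ne_top _ _)]
    exact ENNReal.hasSum_toReal hne
  · intro k
    rw [← measureReal_union]
    · congr 1; ext ω; simp; omega
    · rw [Set.disjoint_left]; intro ω h; simp at h ⊢; omega
    · exact hm _

lemma tail_moment {Ω : Type*} [MeasurableSpace Ω] (μ : Measure Ω) [IsProbabilityMeasure μ]
    (W : Ω → ℝ) (hW : Measurable W) (h0 : ∀ ω, 0 ≤ W ω) (C s : ℝ) (hC : 0 ≤ C) (hs : 0 < s)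
    (ht : ∀ x, 0 < x → μ.real {ω | x < W ω} ≤ C * Real.exp (-(s * x))) (β : ℝ) (hβ : 1 ≤ β) :
    Integrable (fun ω => W ω ^ β) μ ∧
      ∫ ω, W ω ^ β ∂μ ≤ C * ((1 / s) ^ β * Real.Gamma (β + 1)) := by
  have hβ0 : 0 < β := by linarith
  have hint : ∫ t in Set.Ioi (0:ℝ), t ^ (β - 1) * Real.exp (-(s * t)) = (1 / s) ^ β * Real.Gamma β :=
    Real.integral_rpow_mul_exp_neg_mul_Ioi hβ0 hs
  have hG := Real.Gamma_pos_of_pos hβ0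
  have hintb : IntegrableOn (fun t : ℝ => t ^ (β - 1) * Real.exp (-(s * t))) (Set.Ioi 0) :=
    .of_integral_ne_zero (by rw [hint]; positivity)
  have key : ∫⁻ ω, ENNReal.ofReal (W ω ^ β) ∂μ ≤ ENNReal.ofReal (C * ((1 / s) ^ β * Real.Gamma (β + 1))) := by
    rw [lintegral_rpow_eq_lintegral_meas_lt_mul μ (f := W) (Filter.Eventually.of_forall h0) hW.aemeasurable hβ0]
    calc _ ≤ ENNReal.ofReal β * ∫⁻ t in Set.Ioi (0:ℝ), ENNReal.ofReal (C * (t ^ (β - 1) * Real.exp (-(s * t)))) := by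
          refine mul_le_mul_right ?_ _
          refine setLIntegral_mono' (measurableSet_Ioi (a := (0:ℝ))) fun t ht0 => ?_
          have ht0 : 0 < t := ht0
          rw [← ofReal_measureReal, ← ENNReal.ofReal_mul measureReal_nonneg]
          refine ENNReal.ofReal_le_ofReal ?_
          calc _ ≤ (C * Real.exp (-(s * t))) * t ^ (β - 1) := by gcongr; exact ht t ht0
            _ = _ := by ring
      _ = ENNReal.ofReal β * ENNReal.ofReal (C * ((1 / s) ^ β * Real.Gamma β)) := by
          rw [← ofReal_integral_eq_lintegral_ofReal (hintb.const_mul C), integral_const_mul, hint]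
          filter_upwards [ae_restrict_mem measurableSet_Ioi] with t ht0
          have ht0 : 0 < t := ht0
          simp only [Pi.zero_apply]; positivity
      _ = _ := by
          rw [← ENNReal.ofReal_mul hβ0.le, Real.Gamma_add_one hβ0.ne']; congr 1; ring
  have hm : AEStronglyMeasurable (fun ω => W ω ^ β) μ := (hW.pow_const β).aestronglyMeasurable
  have hnn : 0 ≤ᵐ[μ] fun ω => W ω ^ β := Filter.Eventually.of_forall fun ω => Real.rpow_nonneg (h0 ω) β
  have hi : Integrable (fun ω => W ω ^ β) μ :=
    ⟨hm, by rw [hasFiniteIntegral_iff_ofReal hnn]; exact key.trans_lt ENNReal.ofReal_lt_top⟩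
  refine ⟨hi, ?_⟩
  have hG2 := Real.Gamma_pos_of_pos (show 0 < β + 1 by linarith)
  rw [← ofReal_integral_eq_lintegral_ofReal hi hnn] at key
  exact (ENNReal.ofReal_le_ofReal_iff (by positivity)).1 key

/-- qualitative exponential decay of the right tail -/
lemma tail_qual {Ω : Type*} [MeasurableSpace Ω] (μ : Measure Ω) [IsProbabilityMeasure μ]
    (X : Ω → ℤ) (hX : Measurable X)
    (h1 : ∀ k : ℤ, μ.real (X ⁻¹' {k - 1}) * μ.real (X ⁻¹' {k + 1}) ≤ μ.real (X ⁻¹' {k}) ^ 2)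
    (h2 : ∀ a b c : ℤ, a ≤ b → b ≤ c → 0 < μ.real (X ⁻¹' {a}) → 0 < μ.real (X ⁻¹' {c}) →
      0 < μ.real (X ⁻¹' {b})) :
    ∃ C s : ℝ, 0 ≤ C ∧ 0 < s ∧ ∀ x, 0 < x → μ.real {ω | x < (X ω : ℝ)} ≤ C * Real.exp (-(s * x)) := by
  obtain ⟨hlc, hmono⟩ := surv_props μ X hX h1 h2
  set G : ℤ → ℝ := fun k => μ.real {ω | k ≤ X ω} with hGdef
  have hanti : Antitone (fun k : ℤ => {ω | k ≤ X ω}) := fun a b hab ω (h : b ≤ X ω) => hab.trans h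
  have hG0 : ∀ k, 0 ≤ G k := fun _ => measureReal_nonneg
  have hG1 : ∀ k, G k ≤ 1 := fun _ => measureReal_le_one
  have htop : Filter.Tendsto G Filter.atTop (nhds 0) := by
    have := tendsto_measure_iInter_atTop (μ := μ) (s := fun k : ℤ => {ω | k ≤ X ω})
      (fun i => (measurableSet_le measurable_const hX).nullMeasurableSet) hanti ⟨0, measure_ne_top _ _⟩
    have h3 : (⋂ k : ℤ, {ω | k ≤ X ω}) = ∅ := by
      ext ω; simp only [Set.mem_iInter, Set.mem_ofPred_eq, Set.mem_empty_iff_false, iff_false, not_forall]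
      exact ⟨X ω + 1, by omega⟩
    rw [h3, measure_empty] at this
    exact (ENNReal.tendsto_toReal ENNReal.zero_ne_top).comp this
  have hbot : Filter.Tendsto G Filter.atBot (nhds 1) := by
    have := tendsto_measure_iUnion_atBot (μ := μ) (s := fun k : ℤ => {ω | k ≤ X ω}) hanti
    have h3 : (⋃ k : ℤ, {ω | k ≤ X ω}) = Set.univ := by
      ext ω; simp only [Set.mem_iUnion, Set.mem_ofPred_eq, Set.mem_univ, iff_true]
      exact ⟨X ω, le_rfl⟩
    rw [h3, measure_univ] at this
    exact (ENNReal.tendsto_toReal ENNReal.one_ne_top).comp this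
  obtain ⟨a, ha⟩ := (hbot.eventually (lt_mem_nhds (zero_lt_one' ℝ))).exists
  have hex : ∃ k, G (k+1) < G k := by
    by_contra hc
    push Not at hc
    have hc2 : ∀ n : ℕ, G a ≤ G (a + n) := by
      intro n
      induction n with
      | zero => simp
      | succ n ih => have := hc (a+n); push_cast; rw [← add_assoc]; linarith
    obtain ⟨b, hb, hb2⟩ := ((htop.eventually (gt_mem_nhds ha)).and (Filter.eventually_ge_atTop a)).exists
    have := hc2 (b-a).toNat
    rw [show a + ((b-a).toNat:ℤ) = b by omega] at this
    linarith
  obtain ⟨k, hk⟩ := hex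
  have hkp : 0 < G k := (hG0 _).trans_lt hk
  obtain ⟨ρ, hρ1, hρ2⟩ := exists_between ((div_lt_one hkp).2 hk)
  have hρ0 : 0 < ρ := (div_nonneg (hG0 _) hkp.le).trans_lt hρ1
  have hdec := surv_geo G hG0 hlc hmono ρ hρ0.le k ((div_le_iff₀ hkp).1 hρ1.le)
  have hlog : Real.log ρ < 0 := Real.log_neg hρ0 hρ2
  set s := - Real.log ρ with hs
  have hρe : ρ = Real.exp (-s) := by rw [hs, neg_neg, Real.exp_log hρ0]
  refine ⟨Real.exp (s * (|(k:ℝ)| + 2)), s, (Real.exp_pos _).le, by linarith, fun x hx => ?_⟩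
  rw [← Real.exp_add]
  have hspos : 0 < s := by linarith
  by_cases hxk : x ≤ |(k:ℝ)| + 2
  · refine measureReal_le_one.trans (Real.one_le_exp ?_)
    nlinarith
  · push Not at hxk
    have hkabs := le_abs_self (k:ℝ)
    have hfl : k + 1 ≤ ⌊x⌋ := by rw [Int.le_floor]; push_cast; linarith
    have h5 := (hdec (⌊x⌋ - (k+1)).toNat).1
    have hcast : (((⌊x⌋ - (k+1)).toNat : ℤ)) = ⌊x⌋ - (k+1) := by omega
    have hcastR : (((⌊x⌋ - (k+1)).toNat : ℝ)) = ⌊x⌋ - (k+1) := by exact_mod_cast congrArg (Int.cast (R := ℝ)) hcast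
    rw [hcast, add_sub_cancel] at h5
    calc _ ≤ G ⌊x⌋ := measureReal_mono (fun ω (h : x < X ω) => by
            show ⌊x⌋ ≤ X ω
            have := Int.floor_le x
            exact_mod_cast (this.trans h.le))
      _ ≤ _ := h5
      _ ≤ ρ ^ (⌊x⌋ - (k+1)).toNat * 1 := by gcongr; exact hG1 _
      _ ≤ _ := by
        rw [mul_one, hρe, ← Real.exp_nat_mul, hcastR]
        refine Real.exp_le_exp.2 ?_
        have := Int.lt_floor_add_one x
        nlinarith

/-- quantitative decay of the right tail -/
lemma tail_quant {Ω : Type*} [MeasurableSpace Ω] (μ : Measure Ω) [IsProbabilityMeasure μ]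
    (X : Ω → ℤ) (hX : Measurable X)
    (h1 : ∀ k : ℤ, μ.real (X ⁻¹' {k - 1}) * μ.real (X ⁻¹' {k + 1}) ≤ μ.real (X ⁻¹' {k}) ^ 2)
    (h2 : ∀ a b c : ℤ, a ≤ b → b ≤ c → 0 < μ.real (X ⁻¹' {a}) → 0 < μ.real (X ⁻¹' {c}) →
      0 < μ.real (X ⁻¹' {b}))
    (m : ℝ) (hi1 : Integrable (fun ω => (X ω : ℝ) - m) μ) (hm : ∫ ω, ((X ω : ℝ) - m) ∂μ = 0)
    (hi2 : Integrable (fun ω => ((X ω : ℝ) - m) ^ 2) μ) (hv : ∫ ω, ((X ω : ℝ) - m) ^ 2 ∂μ ≤ 1)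
    (x : ℝ) (hx : 6 ≤ x) :
    μ.real {ω | x < (X ω : ℝ) - m} ≤ (1 / 25) * Real.exp (-(21/50 * (x - 6))) := by
  obtain ⟨hlc, hmono⟩ := surv_props μ X hX h1 h2
  set G : ℤ → ℝ := fun k => μ.real {ω | k ≤ X ω} with hGdef
  have hG0 : ∀ k, 0 ≤ G k := fun _ => measureReal_nonneg
  have hfl := Int.floor_le m
  have hfl2 := Int.lt_floor_add_one m
  have hlow : 1 / 2 ≤ G ⌊m⌋ := by
    have hI : Integrable (fun ω => ((X ω : ℝ) - m - 1) ^ 2) μ := by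
      have := (hi2.sub (hi1.const_mul 2)).add (integrable_const (1:ℝ))
      refine this.congr (Filter.Eventually.of_forall fun ω => ?_)
      simp; ring
    have hIv : ∫ ω, ((X ω : ℝ) - m - 1) ^ 2 ∂μ ≤ 2 := by
      have : ∫ ω, ((X ω : ℝ) - m - 1) ^ 2 ∂μ = ∫ ω, (((X ω : ℝ) - m) ^ 2 - 2 * ((X ω : ℝ) - m)) + 1 ∂μ := by
        congr 1; ext ω; ring
      rw [this, integral_add (f := fun ω => ((X ω : ℝ) - m) ^ 2 - 2 * ((X ω : ℝ) - m)) (hi2.sub (hi1.const_mul 2)) (integrable_const _), integral_sub hi2 (hi1.const_mul 2),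
        integral_const_mul, hm]
      simp; linarith
    have hM := mul_meas_ge_le_integral_of_nonneg (μ := μ) (Filter.Eventually.of_forall fun ω => sq_nonneg ((X ω : ℝ) - m - 1)) hI 4
    have hc : μ.real {ω | ⌊m⌋ ≤ X ω}ᶜ ≤ μ.real {ω | 4 ≤ ((X ω : ℝ) - m - 1) ^ 2} := by
      refine measureReal_mono (fun ω h => ?_)
      simp only [Set.mem_compl_iff, Set.mem_ofPred_eq, not_le] at h ⊢
      have : (X ω : ℝ) + 1 ≤ ⌊m⌋ := by exact_mod_cast h
      nlinarith
    rw [probReal_compl_eq_one_sub (measurableSet_le measurable_const hX)] at hc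
    simp only [hGdef]
    linarith
  have hhigh : G (⌊m⌋ + 6) ≤ 1 / 25 := by
    have hM := mul_meas_ge_le_integral_of_nonneg (μ := μ) (Filter.Eventually.of_forall fun ω => sq_nonneg ((X ω : ℝ) - m)) hi2 25
    have hc : G (⌊m⌋ + 6) ≤ μ.real {ω | 25 ≤ ((X ω : ℝ) - m) ^ 2} := by
      refine measureReal_mono (fun ω h => ?_)
      simp only [Set.mem_ofPred_eq] at h ⊢
      have : (⌊m⌋ : ℝ) + 6 ≤ X ω := by exact_mod_cast h
      nlinarith
    linarith
  have he : (2/25 : ℝ) ≤ Real.exp (-(21/50)) ^ 6 := by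
    rw [← Real.exp_nat_mul]
    have h3 : Real.exp (((6:ℕ):ℝ) * -(21/50)) = (Real.exp 1 ^ 2)⁻¹ * (Real.exp (26/50))⁻¹ := by
      rw [← Real.exp_nat_mul, ← Real.exp_neg, ← Real.exp_neg, ← Real.exp_add]; congr 1; norm_num
    rw [h3]
    have h4 := Real.exp_one_lt_d9
    have h5 : Real.exp (26/50) ≤ 1.6821 := by
      have := Real.exp_bound' (x := 26/50) (by norm_num) (by norm_num) (n := 5) (by norm_num)
      refine this.trans ?_
      norm_num [Finset.sum_range_succ, Nat.factorial]
    rw [← mul_inv, le_inv_comm₀ (by norm_num) (by positivity)]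
    calc Real.exp 1 ^ 2 * Real.exp (26/50) ≤ 2.7182818286 ^ 2 * 1.6821 := by gcongr
      _ ≤ _ := by norm_num
  have hstart : G (⌊m⌋ + (5:ℕ) + 1) ≤ Real.exp (-(21/50)) ^ (5+1) * G ⌊m⌋ := by
    rw [show ⌊m⌋ + ((5:ℕ):ℤ) + 1 = ⌊m⌋ + 6 by push_cast; ring]
    calc _ ≤ 2/25 * (1/2 : ℝ) := by linarith
      _ ≤ _ := by gcongr
  have hgeo := surv_geo_n G hG0 hlc hmono (Real.exp (-(21/50))) (Real.exp_pos _).le ⌊m⌋ 5 hstart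
  have hfx := Int.lt_floor_add_one (x + m)
  have hfx2 : ⌊m⌋ + 6 ≤ ⌊x + m⌋ := by rw [Int.le_floor]; push_cast; linarith
  have h5 := hgeo (⌊x + m⌋ + 1 - (⌊m⌋ + 6)).toNat
  have hcast : (((⌊x + m⌋ + 1 - (⌊m⌋ + 6)).toNat : ℤ)) = ⌊x + m⌋ + 1 - (⌊m⌋ + 6) := by omega
  have hcastR : (((⌊x + m⌋ + 1 - (⌊m⌋ + 6)).toNat : ℝ)) = ⌊x + m⌋ + 1 - (⌊m⌋ + 6) := by
    exact_mod_cast congrArg (Int.cast (R := ℝ)) hcast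
  rw [show ⌊m⌋ + ((5:ℕ):ℤ) + 1 = ⌊m⌋ + 6 by push_cast; ring, hcast, add_sub_cancel] at h5
  calc _ ≤ G (⌊x+m⌋ + 1) := measureReal_mono (fun ω (h : x < X ω - m) => by
          show ⌊x+m⌋ + 1 ≤ X ω
          have : ⌊x+m⌋ < X ω := by rw [Int.floor_lt]; linarith
          omega)
    _ ≤ _ := h5
    _ ≤ Real.exp (-(21/50)) ^ (⌊x + m⌋ + 1 - (⌊m⌋ + 6)).toNat * (1/25) := by gcongr
    _ ≤ _ := by
      rw [mul_comm, ← Real.exp_nat_mul, hcastR]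
      gcongr
      linarith

lemma cheb_num (x : ℝ) (h1 : 1 ≤ x) (h6 : x ≤ 6) : 1 / x ^ 2 ≤ (63/50)^2 * Real.exp (-(21/50 * x)) := by
  have hx : 0 < x := by linarith
  have he : Real.exp (21/50 * x) ≤ (63/50)^2 * x ^ 2 := by
    have h3 : Real.exp (21/100 * x) ≤ 63/50 * x := by
      have ha : Real.exp (21/100) ≤ 63/50 := by
        have := Real.exp_bound' (x := 21/100) (by norm_num) (by norm_num) (n := 3) (by norm_num)
        refine this.trans ?_
        norm_num [Finset.sum_range_succ, Nat.factorial]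
      have hb : Real.exp (126/100) ≤ 63/50 * 6 := by
        have h : Real.exp (126/100) = Real.exp (21/100) ^ 6 := by
          rw [← Real.exp_nat_mul]; congr 1; norm_num
        rw [h]
        calc _ ≤ (63/50 : ℝ)^6 := by gcongr
          _ ≤ _ := by norm_num
      have hc := convexOn_exp.2 (Set.mem_univ (21/100:ℝ)) (Set.mem_univ (126/100:ℝ))
        (show 0 ≤ (6 - x)/5 by linarith) (show 0 ≤ (x-1)/5 by linarith) (by ring)
      simp only [smul_eq_mul] at hc
      rw [show (6 - x)/5 * (21/100) + (x-1)/5*(126/100) = 21/100*x by ring] at hc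
      have : (6 - x)/5 * Real.exp (21/100) ≤ (6 - x)/5 * (63/50) := by
        apply mul_le_mul_of_nonneg_left ha; linarith
      have : (x-1)/5 * Real.exp (126/100) ≤ (x-1)/5 * (63/50*6) := by
        apply mul_le_mul_of_nonneg_left hb; linarith
      linarith
    calc Real.exp (21/50 * x) = Real.exp (21/100*x) ^ 2 := by rw [← Real.exp_nat_mul]; congr 1; push_cast; ring
      _ ≤ (63/50 * x)^2 := by gcongr
      _ = _ := by ring
  rw [Real.exp_neg, div_le_iff₀ (by positivity)]
  have := Real.exp_pos (21/50*x)
  rw [show (63/50:ℝ)^2 * (Real.exp (21/50*x))⁻¹ * x^2 = ((63/50)^2 * x^2) / Real.exp (21/50*x) by ring, le_div_iff₀ this]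
  linarith

lemma main_general {Ω : Type*} [MeasurableSpace Ω] (μ : Measure Ω) [IsProbabilityMeasure μ]
    (X : Ω → ℤ) (hX : Measurable X)
    (h1 : ∀ k : ℤ, μ.real (X ⁻¹' {k - 1}) * μ.real (X ⁻¹' {k + 1}) ≤ μ.real (X ⁻¹' {k}) ^ 2)
    (h2 : ∀ a b c : ℤ, a ≤ b → b ≤ c → 0 < μ.real (X ⁻¹' {a}) → 0 < μ.real (X ⁻¹' {c}) →
      0 < μ.real (X ⁻¹' {b}))
    (m : ℝ) (hm : m = ∫ ω, (X ω : ℝ) ∂μ) (hv : ∫ ω, ((X ω : ℝ) - m) ^ 2 ∂μ ≤ 1)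
    (β : ℝ) (hβ : 1 ≤ β) :
    ∫ ω, |(X ω : ℝ) - m| ^ β ∂μ ≤ 3 ^ β * Real.Gamma (β + 1) := by
  have hXr : Measurable (fun ω => (X ω : ℝ)) := measurable_from_top.comp hX
  have hN : Measurable (fun ω => - X ω) := hX.neg
  have hpre : ∀ k : ℤ, (fun ω => - X ω) ⁻¹' {k} = X ⁻¹' {-k} := by
    intro k; ext ω; simp; omega
  have h1' : ∀ k : ℤ, μ.real ((fun ω => - X ω) ⁻¹' {k - 1}) * μ.real ((fun ω => - X ω) ⁻¹' {k + 1}) ≤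
      μ.real ((fun ω => - X ω) ⁻¹' {k}) ^ 2 := by
    intro k
    simp only [hpre]
    have := h1 (-k)
    rw [show -(k-1) = -k + 1 by ring, show -(k+1) = -k - 1 by ring]
    linarith
  have h2' : ∀ a b c : ℤ, a ≤ b → b ≤ c → 0 < μ.real ((fun ω => - X ω) ⁻¹' {a}) →
      0 < μ.real ((fun ω => - X ω) ⁻¹' {c}) → 0 < μ.real ((fun ω => - X ω) ⁻¹' {b}) := by
    intro a b c hab hbc ha hc
    simp only [hpre] at ha hc ⊢
    exact h2 (-c) (-b) (-a) (by omega) (by omega) hc ha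
  have hsplit : ∀ (Y : Ω → ℝ) (x : ℝ), μ.real {ω | x < |Y ω|} ≤ μ.real {ω | x < Y ω} + μ.real {ω | x < - Y ω} := by
    intro Y x
    refine le_trans (measureReal_mono ?_) (measureReal_union_le _ _)
    intro ω (h : x < |Y ω|)
    exact lt_abs.1 h
  -- integrability
  obtain ⟨C₁, s₁, hC₁, hs₁, ht₁⟩ := tail_qual μ X hX h1 h2
  obtain ⟨C₂, s₂, hC₂, hs₂, ht₂⟩ := tail_qual μ (fun ω => - X ω) hN h1' h2'
  have hsm : 0 < min s₁ s₂ := lt_min hs₁ hs₂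
  have hmom := fun β hβ => (tail_moment μ (fun ω => |(X ω : ℝ)|) hXr.abs (fun _ => abs_nonneg _) (C₁ + C₂) (min s₁ s₂)
    (by positivity) hsm (by
      intro x hx
      refine (hsplit (fun ω => (X ω : ℝ)) x).trans ?_
      have a := ht₁ x hx
      have b := ht₂ x hx
      push_cast at b
      have a' : Real.exp (-(s₁ * x)) ≤ Real.exp (-(min s₁ s₂ * x)) := by
        gcongr; exact min_le_left _ _
      have b' : Real.exp (-(s₂ * x)) ≤ Real.exp (-(min s₁ s₂ * x)) := by
        gcongr; exact min_le_right _ _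
      have := mul_le_mul_of_nonneg_left a' hC₁
      have := mul_le_mul_of_nonneg_left b' hC₂
      rw [add_mul]
      linarith) β hβ).1
  have hI1 : Integrable (fun ω => (X ω : ℝ)) μ := by
    have := hmom 1 le_rfl
    simp only [Real.rpow_one] at this
    exact (integrable_norm_iff hXr.aestronglyMeasurable).1 this
  have hI2 : Integrable (fun ω => (X ω : ℝ)^2) μ := by
    have := hmom 2 one_le_two
    simpa only [Real.rpow_two, sq_abs] using this
  have hi1 : Integrable (fun ω => (X ω : ℝ) - m) μ := hI1.sub (integrable_const _)
  have hi2 : Integrable (fun ω => ((X ω : ℝ) - m)^2) μ := by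
    have := (hI2.sub (hI1.const_mul (2*m))).add (integrable_const (m^2))
    refine this.congr (Filter.Eventually.of_forall fun ω => ?_)
    simp; ring
  have hmean : ∫ ω, ((X ω : ℝ) - m) ∂μ = 0 := by
    rw [integral_sub hI1 (integrable_const _), ← hm]; simp
  have hYm : Measurable (fun ω => |(X ω : ℝ) - m|) := (hXr.sub_const m).abs
  rcases le_total β 2 with hb2 | hb2
  · -- small exponent
    have hGam : 1 ≤ Real.Gamma (β + 1) := by
      refine Real.Gamma_two.ge.trans ?_
      exact Real.Gamma_strictMonoOn_Ici.monotoneOn (by simp) (by simp; linarith) (by linarith)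
    have h3 : (3:ℝ) ≤ 3 ^ β := Real.self_le_rpow_of_one_le (by norm_num) hβ
    have hle : ∫ ω, |(X ω : ℝ) - m| ^ β ∂μ ≤ ∫ ω, (1 + ((X ω : ℝ) - m)^2) ∂μ := by
      refine integral_mono_of_nonneg (Filter.Eventually.of_forall fun ω => by simp only [Pi.zero_apply]; positivity)
        ((integrable_const _).add hi2) (Filter.Eventually.of_forall fun ω => ?_)
      simp only
      rcases le_total |(X ω : ℝ) - m| 1 with h | h
      · have := Real.rpow_le_one (abs_nonneg _) h (show 0 ≤ β by linarith)
        nlinarith [sq_nonneg ((X ω : ℝ) - m)]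
      · have := Real.rpow_le_rpow_of_exponent_le h hb2
        rw [Real.rpow_two, sq_abs] at this
        linarith
    rw [integral_add (integrable_const _) hi2] at hle
    simp at hle
    nlinarith
  · have htail : ∀ x, 0 < x → μ.real {ω | x < |(X ω : ℝ) - m|} ≤ (63/50)^2 * Real.exp (-(21/50 * x)) := by
      intro x hx
      rcases le_total x 1 with hx1 | hx1
      · refine measureReal_le_one.trans ?_
        refine (show (1:ℝ) ≤ (63/50)^2 * Real.exp (-(21/50 * 1)) from ?_).trans (by gcongr)
        have := cheb_num 1 le_rfl (by norm_num)
        simpa using this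
      rcases le_total x 6 with hx6 | hx6
      · refine le_trans ?_ (cheb_num x hx1 hx6)
        have hM := mul_meas_ge_le_integral_of_nonneg (μ := μ) (Filter.Eventually.of_forall fun ω => sq_nonneg ((X ω : ℝ) - m)) hi2 (x^2)
        have hc : μ.real {ω | x < |(X ω : ℝ) - m|} ≤ μ.real {ω | x^2 ≤ ((X ω : ℝ) - m) ^ 2} := by
          refine measureReal_mono (fun ω (h : x < |(X ω : ℝ) - m|) => ?_)
          show x^2 ≤ ((X ω : ℝ) - m) ^ 2
          rw [← sq_abs ((X ω : ℝ) - m)]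
          gcongr
        refine hc.trans ?_
        rw [le_div_iff₀ (by positivity)]
        linarith
      · refine (hsplit (fun ω => (X ω : ℝ) - m) x).trans ?_
        have a := tail_quant μ X hX h1 h2 m hi1 hmean hi2 hv x hx6
        have e : (fun ω => (((- X ω : ℤ) : ℝ)) - (-m)) = fun ω => -((X ω : ℝ) - m) := by
          ext ω; push_cast; ring
        have e2 : (fun ω => ((((- X ω : ℤ) : ℝ)) - (-m))^2) = fun ω => ((X ω : ℝ) - m)^2 := by
          ext ω; push_cast; ring
        have b := tail_quant μ (fun ω => - X ω) hN h1' h2' (-m) (by rw [e]; exact hi1.neg)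
          (by rw [e, integral_neg, hmean, neg_zero]) (by rw [e2]; exact hi2) (by rw [e2]; exact hv) x hx6
        have e3 : {ω | x < (((- X ω : ℤ) : ℝ)) - (-m)} = {ω | x < -((X ω : ℝ) - m)} := by
          ext ω; simp only [Set.mem_ofPred_eq]; rw [show (((- X ω : ℤ) : ℝ)) - (-m) = -((X ω : ℝ) - m) by push_cast; ring]
        rw [e3] at b
        have hexp : Real.exp (-(21/50 * (x - 6))) = Real.exp (21/50) ^ 6 * Real.exp (-(21/50*x)) := by
          rw [← Real.exp_nat_mul, ← Real.exp_add]; congr 1; push_cast; ring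
        have h16 : Real.exp (21/50) ≤ (63/50)^2 := by
          have := cheb_num 1 le_rfl (by norm_num)
          rw [Real.exp_neg] at this
          have h0 := Real.exp_pos (21/50 * 1)
          rw [← div_eq_mul_inv, le_div_iff₀ h0] at this
          simpa using this
        have h17 : Real.exp (21/50) ^ 6 ≤ ((63/50)^2)^6 := by gcongr
        rw [hexp] at a b
        have h0 := Real.exp_pos (-(21/50*x))
        have : Real.exp (21/50) ^ 6 * Real.exp (-(21/50*x)) ≤ ((63/50)^2)^6 * Real.exp (-(21/50*x)) := by gcongr
        norm_num at this ⊢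
        norm_num at a b
        linarith
    refine (tail_moment μ (fun ω => |(X ω : ℝ) - m|) hYm (fun _ => abs_nonneg _) ((63/50)^2) (21/50)
      (by norm_num) (by norm_num) htail β hβ).2.trans ?_
    have hG := Real.Gamma_pos_of_pos (show 0 < β + 1 by linarith)
    rw [← mul_assoc]
    gcongr
    calc (63/50:ℝ)^2 * (1/(21/50))^β ≤ (63/50:ℝ)^β * (1/(21/50))^β := by
          gcongr
          rw [← Real.rpow_two]
          exact Real.rpow_le_rpow_of_exponent_le (by norm_num) hb2
      _ = 3 ^ β := by rw [← Real.mul_rpow (by norm_num) (by norm_num)]; norm_num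

/-- If `X` is a log-concave integer-valued random variable with `Var(X) ≤ 1`, then
for all `β ≥ 1`, `E[|X − E[X]|^β]^(1/β) ≤ 3·Γ(β+1)^(1/β)`. -/
theorem centered_moment_bound_isotropic
    {Ω : Type*} [MeasureSpace Ω] [IsProbabilityMeasure (ℙ : Measure Ω)]
    (X : Ω → ℤ) (hX : Measurable X)
    (hlc : IsLogConcavePMF (fun k => (ℙ (X ⁻¹' {k})).toReal))
    (m : ℝ) (hm : m = ∫ ω, (X ω : ℝ))
    (hvar : (∫ ω, ((X ω : ℝ) - m) ^ 2) ≤ 1)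
    (β : ℝ) (hβ : 1 ≤ β) :
    (∫ ω, |(X ω : ℝ) - m| ^ β) ^ (1 / β) ≤ 3 * Real.Gamma (β + 1) ^ (1 / β) := by
  have hb : 0 < β := by linarith
  have h := main_general (ℙ : Measure Ω) X hX hlc.1 hlc.2 m hm hvar β hβ
  have hG := Real.Gamma_pos_of_pos (show 0 < β + 1 by linarith)
  calc (∫ ω, |(X ω : ℝ) - m| ^ β) ^ (1 / β) ≤ (3 ^ β * Real.Gamma (β + 1)) ^ (1 / β) := by
        refine Real.rpow_le_rpow (integral_nonneg fun ω => ?_) h (by positivity)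
        simp only [Pi.zero_apply]; positivity
    _ = _ := by
      rw [Real.mul_rpow (by positivity) hG.le, ← Real.rpow_mul (by norm_num), mul_one_div_cancel hb.ne', Real.rpow_one]
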